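/- arXiv:2003.08125 — 9 statements merged into one kernel-verified Lean document; each statement's English description precedes it below -/
import Mathlib

section
/- Let there be n ≥ 1 agents with superadditive valuations and let X be a transfer-stable allocation of the tasks. Define payments by p_i = v_i(X_i) - SW(X)/n (the Knaster payments). Then the outcome (X,p) is both envy-free and equitable. -/
open Finset

/-- `X` is an allocation: the bundles are pairwise disjoint and cover all tasks. -/
def IsAllocation {n : ℕ} {α : Type*} [Fintype α] [DecidableEq α]
    (X : Fin n → Finset α) : Prop :=
  (∀ i j : Fin n, i ≠ j → Disjoint (X i) (X j)) ∧
    Finset.univ.biUnion X = (Finset.univ : Finset α)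

/-- `v` is superadditive. -/
def SuperadditiveVal {α : Type*} [DecidableEq α] (v : Finset α → ℝ) : Prop :=
  ∀ A B : Finset α, Disjoint A B → v A + v B ≤ v (A ∪ B)

/-- `v` is additive. -/
def AdditiveVal {α : Type*} [DecidableEq α] (v : Finset α → ℝ) : Prop :=
  ∀ A B : Finset α, Disjoint A B → v (A ∪ B) = v A + v B

/-- Social welfare of allocation `X`. -/
def socialWelfare {n : ℕ} {α : Type*} (v : Fin n → Finset α → ℝ)
    (X : Fin n → Finset α) : ℝ :=
  ∑ i, v i (X i)

/-- `X` is transfer-stable: no agent `i` can take agent `j`'s whole bundle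
with a welfare gain. -/
def TransferStable {n : ℕ} {α : Type*} [DecidableEq α]
    (v : Fin n → Finset α → ℝ) (X : Fin n → Finset α) : Prop :=
  ¬ ∃ i j : Fin n, i ≠ j ∧ v i (X i) + v j (X j) < v i (X i ∪ X j)

/-- The outcome `(X, p)` is envy-free. -/
def EnvyFree {n : ℕ} {α : Type*} (v : Fin n → Finset α → ℝ)
    (X : Fin n → Finset α) (p : Fin n → ℝ) : Prop :=
  ∀ i j : Fin n, v i (X j) - p j ≤ v i (X i) - p i

/-- The outcome `(X, p)` is equitable. -/
def Equitable {n : ℕ} {α : Type*} (v : Fin n → Finset α → ℝ)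
    (X : Fin n → Finset α) (p : Fin n → ℝ) : Prop :=
  ∀ i j : Fin n, v i (X i) - p i = v j (X j) - p j

/-- `X` is reassignment-stable: no permutation of the bundles among the agents
increases social welfare. -/
def ReassignmentStable {n : ℕ} {α : Type*} (v : Fin n → Finset α → ℝ)
    (X : Fin n → Finset α) : Prop :=
  ∀ σ : Equiv.Perm (Fin n), ∑ i, v i (X (σ i)) ≤ ∑ i, v i (X i)

/-- For `n ≥ 1` agents with superadditive valuations and a
transfer-stable allocation `X`, the Knaster payments
`p i = v i (X i) - SW(X)/n` yield an envy-free and equitable outcome. -/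
theorem knaster_payments_envyFree_and_equitable
    {n : ℕ} {α : Type*} [Fintype α] [DecidableEq α]
    (hn : 1 ≤ n) (v : Fin n → Finset α → ℝ)
    (hv0 : ∀ i, v i ∅ = 0)
    (hsa : ∀ i, SuperadditiveVal (v i))
    (X : Fin n → Finset α) (hX : IsAllocation X)
    (hts : TransferStable v X)
    (p : Fin n → ℝ) (hp : ∀ i, p i = v i (X i) - socialWelfare v X / n) :
    EnvyFree v X p ∧ Equitable v X p := by
  constructor
  · intro i j
    by_cases hij : i = j
    · subst hij
      exact le_refl _
    · have h1 := hsa i (X i) (X j) (hX.1 i j hij)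
      have h2 : v i (X i ∪ X j) ≤ v i (X i) + v j (X j) := by
        by_contra h
        exact hts ⟨i, j, hij, not_le.mp h⟩
      rw [hp i, hp j]
      linarith
  · intro i j
    rw [hp i, hp j]
    ring
end

section
/- Under additive valuations, if an allocation X is transfer-stable, then it is reassignment-stable, i.e., for every permutation σ of the agents, Σ_i v_i(X_{σ(i)}) ≤ Σ_i v_i(X_i). -/
open Finset

/-- Under additive valuations, transfer-stability implies
reassignment-stability. -/
theorem transferStable_imp_reassignmentStable
    {n : ℕ} {α : Type*} [Fintype α] [DecidableEq α]
    (v : Fin n → Finset α → ℝ)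
    (hv0 : ∀ i, v i ∅ = 0)
    (hadd : ∀ i, AdditiveVal (v i))
    (X : Fin n → Finset α) (hX : IsAllocation X)
    (hts : TransferStable v X) :
    ReassignmentStable v X := by
  intro σ
  rw [← Equiv.sum_comp σ (fun i => v i (X i))]
  refine Finset.sum_le_sum fun i _ => ?_
  by_cases h : i = σ i
  · rw [← h]
  · by_contra hlt
    refine hts ⟨i, σ i, h, ?_⟩
    rw [hadd i _ _ (hX.1 i (σ i) h)]
    linarith [not_le.mp hlt]
end

section
/- Under additive valuations, if an allocation X is EFEQ-convertible (there exist payments p such that the outcome (X,p) is both envy-free and equitable), then X is transfer-stable. -/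
open Finset

/-- Under additive valuations, if an allocation is
EFEQ-convertible then it is transfer-stable. -/
theorem efeq_convertible_imp_transferStable
    {n : ℕ} {α : Type*} [Fintype α] [DecidableEq α]
    (v : Fin n → Finset α → ℝ)
    (hv0 : ∀ i, v i ∅ = 0)
    (hadd : ∀ i, AdditiveVal (v i))
    (X : Fin n → Finset α) (hX : IsAllocation X)
    (hefeq : ∃ p : Fin n → ℝ, EnvyFree v X p ∧ Equitable v X p) :
    TransferStable v X := by
  rintro ⟨i, j, hij, h⟩
  obtain ⟨p, hef, heq⟩ := hefeq
  have h1 := hadd i _ _ (hX.1 i j hij)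
  have h2 := hef i j
  have h3 := heq i j
  linarith
end

section
/- Under additive valuations, an allocation X is EFEQ-convertible if and only if it is transfer-stable. -/
open Finset

/-- Under additive valuations, an allocation is EFEQ-convertible
iff it is transfer-stable. -/
theorem efeq_convertible_iff_transferStable
    {n : ℕ} {α : Type*} [Fintype α] [DecidableEq α]
    (v : Fin n → Finset α → ℝ)
    (hv0 : ∀ i, v i ∅ = 0)
    (hadd : ∀ i, AdditiveVal (v i))
    (X : Fin n → Finset α) (hX : IsAllocation X) :
    (∃ p : Fin n → ℝ, EnvyFree v X p ∧ Equitable v X p) ↔ TransferStable v X := by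
  constructor
  · rintro ⟨p, hef, heq⟩ ⟨i, j, hij, h⟩
    rw [hadd i _ _ (hX.1 i j hij)] at h
    have h1 := hef i j
    have h2 := heq i j
    linarith
  · intro h
    refine ⟨fun i => v i (X i), ?_, ?_⟩
    · intro i j
      by_cases hij : i = j
      · subst hij
        exact le_refl _
      · have h1 : ¬ (v i (X i) + v j (X j) < v i (X i ∪ X j)) :=
          fun hlt => h ⟨i, j, hij, hlt⟩
        rw [hadd i _ _ (hX.1 i j hij)] at h1
        dsimp only
        linarith
    · intro i j
      simp
end

section
/- Under superadditive valuations, any allocation that maximizes social welfare over all allocations is EFEQ-convertible, i.e., there exist payments p such that the outcome (X,p) is both envy-free and equitable. -/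
open Finset

/-- Under superadditive valuations, a social-welfare maximizing
allocation is EFEQ-convertible. -/
theorem welfareMaximizing_efeq_convertible
    {n : ℕ} {α : Type*} [Fintype α] [DecidableEq α]
    (v : Fin n → Finset α → ℝ)
    (hv0 : ∀ i, v i ∅ = 0)
    (hsa : ∀ i, SuperadditiveVal (v i))
    (X : Fin n → Finset α) (hX : IsAllocation X)
    (hmax : ∀ Y : Fin n → Finset α, IsAllocation Y →
      socialWelfare v Y ≤ socialWelfare v X) :
    ∃ p : Fin n → ℝ, EnvyFree v X p ∧ Equitable v X p := by
  have key : ∀ i j : Fin n, v i (X j) ≤ v j (X j) := by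
    intro i j
    by_cases hij : i = j
    · subst hij; exact le_rfl
    have hji : j ≠ i := fun h => hij h.symm
    let Y : Fin n → Finset α := fun k => if k = i then X i ∪ X j else if k = j then ∅ else X k
    have hYi : Y i = X i ∪ X j := by simp [Y]
    have hYj : Y j = ∅ := by simp [Y, hji]
    have hYk : ∀ k, k ≠ i → k ≠ j → Y k = X k := by
      intro k h1 h2
      simp [Y, h1, h2]
    have hY : IsAllocation Y := by
      obtain ⟨hd, hc⟩ := hX
      constructor
      · intro a b hab
        rw [Finset.disjoint_left]
        have hd' : ∀ a b x, x ∈ X a → x ∈ X b → a = b := by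
          intro a b x h1 h2
          by_contra h
          exact Finset.disjoint_left.mp (hd a b h) h1 h2
        intro x hxa hxb
        simp only [Y] at hxa hxb
        grind
      · ext x
        simp only [Finset.mem_biUnion, Finset.mem_univ, true_and, iff_true]
        have hx : x ∈ Finset.univ.biUnion X := by rw [hc]; exact Finset.mem_univ x
        obtain ⟨k, -, hk⟩ := Finset.mem_biUnion.mp hx
        by_cases h1 : k = i
        · exact ⟨i, by rw [hYi]; subst h1; exact Finset.mem_union_left _ hk⟩
        by_cases h2 : k = j
        · exact ⟨i, by rw [hYi]; subst h2; exact Finset.mem_union_right _ hk⟩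
        exact ⟨k, by rw [hYk k h1 h2]; exact hk⟩
    have h1 := hmax Y hY
    have h2 : ∑ k, (v k (Y k) - v k (X k)) =
        (v i (Y i) - v i (X i)) + (v j (Y j) - v j (X j)) := by
      apply Fintype.sum_eq_add i j hij
      rintro k ⟨hk1, hk2⟩
      rw [hYk k hk1 hk2, sub_self]
    rw [Finset.sum_sub_distrib, hYi, hYj, hv0] at h2
    have h3 := hsa i (X i) (X j) (hX.1 i j hij)
    unfold socialWelfare at h1
    linarith
  refine ⟨fun i => v i (X i), ?_, ?_⟩
  · intro i j
    have := key i j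
    simp only [sub_self]
    linarith
  · intro i j
    simp
end

section
/- Under (positive) additive valuations, an allocation X is envy-freeable (there exist payments p making the outcome (X,p) envy-free) if and only if X is reassignment-stable, i.e., for every permutation σ of the agents, Σ_i v_i(X_{σ(i)}) ≤ Σ_i v_i(X_i). -/
open Finset

/-- Weight of a path, listed from its end vertex to its start vertex. -/
def pathWeight {ι : Type*} (w : ι → ι → ℝ) : List ι → ℝ
  | [] => 0
  | [_] => 0
  | a :: b :: t => w b a + pathWeight w (b :: t)

theorem pathWeight_split {ι : Type*} (w : ι → ι → ℝ) (j : ι) (l₁ : List ι) :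
    ∀ l₂ : List ι, pathWeight w (l₂ ++ j :: l₁)
      = pathWeight w (l₂ ++ [j]) + pathWeight w (j :: l₁)
  | [] => by simp [pathWeight]
  | [a] => by simp [pathWeight]
  | a :: b :: t => by
      have h := pathWeight_split w j l₁ (b :: t)
      simp only [List.cons_append, pathWeight] at h ⊢
      rw [h]; ring

theorem exists_cycle {ι : Type*} [Fintype ι] [DecidableEq ι] (w : ι → ι → ℝ)
    (hw : ∀ i, w i i = 0) :
    ∀ (t : List ι) (b : ι), (b :: t).Nodup → ∃ σ : Equiv.Perm ι,
      (∀ x, x ∉ b :: t → σ x = x) ∧ σ b = (b :: t).getLast (by simp) ∧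
      ∑ i, w i (σ i) = pathWeight w (b :: t) + w b (σ b)
  | [], b, _ => ⟨1, by simp, by simp, by simp [pathWeight, hw]⟩
  | c :: t, a, hnd => by
      obtain ⟨σ, h1, h2, h3⟩ := exists_cycle w hw t c (List.nodup_cons.1 hnd).2
      have ha : a ∉ c :: t := (List.nodup_cons.1 hnd).1
      have hac : a ≠ c := fun h => ha (by simp [h])
      have hσa := h1 a ha
      refine ⟨σ * Equiv.swap a c, ?_, ?_, ?_⟩
      · intro x hx
        have hxa : x ≠ a := fun h => hx (by simp [h])
        have hxc : x ≠ c := fun h => hx (by simp [h])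
        rw [Equiv.Perm.mul_apply, Equiv.swap_apply_of_ne_of_ne hxa hxc]
        exact h1 x (fun h => hx (List.mem_cons_of_mem _ h))
      · rw [Equiv.Perm.mul_apply, Equiv.swap_apply_left, h2]
        simp
      · have key : ∀ f : ι → ℝ, ∑ i, f i
            = f a + (f c + ∑ i ∈ (Finset.univ.erase a).erase c, f i) := by
          intro f
          rw [Finset.add_sum_erase _ _ (by simp [hac.symm]), Finset.add_sum_erase _ _ (by simp)]
        have hrest : ∑ i ∈ (Finset.univ.erase a).erase c, w i ((σ * Equiv.swap a c) i)
            = ∑ i ∈ (Finset.univ.erase a).erase c, w i (σ i) := by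
          refine Finset.sum_congr rfl fun i hi => ?_
          simp only [Finset.mem_erase, Finset.mem_univ, and_true] at hi
          rw [Equiv.Perm.mul_apply, Equiv.swap_apply_of_ne_of_ne hi.2 hi.1]
        rw [key] at h3
        rw [key, hrest]
        simp only [Equiv.Perm.mul_apply, Equiv.swap_apply_left, Equiv.swap_apply_right, hσa, hw,
          pathWeight] at h3 ⊢
        linarith

theorem exists_potential {ι : Type*} [Fintype ι] [DecidableEq ι] (w : ι → ι → ℝ)
    (hw : ∀ i, w i i = 0) (hσ : ∀ σ : Equiv.Perm ι, ∑ i, w i (σ i) ≤ 0) :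
    ∃ p : ι → ℝ, ∀ i j, p i + w i j ≤ p j := by
  have hmax : ∀ j : ι, ∃ l : List ι, (j :: l).Nodup ∧
      ∀ l' : List ι, (j :: l').Nodup → pathWeight w (j :: l') ≤ pathWeight w (j :: l) := by
    intro j
    have hfin : {l : List ι | (j :: l).Nodup}.Finite := by
      have h0 : {l : List ι | l.Nodup}.Finite :=
        (List.finite_length_le ι (Fintype.card ι)).subset fun l hl => hl.length_le_card
      exact h0.subset fun l hl => (List.nodup_cons.1 hl).2
    obtain ⟨l, hl, hm⟩ := Set.exists_max_image _ (fun l => pathWeight w (j :: l)) hfin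
      ⟨[], by simp⟩
    exact ⟨l, hl, hm⟩
  choose L hL hLm using hmax
  refine ⟨fun j => pathWeight w (j :: L j), fun i j => ?_⟩
  by_cases hj : j ∈ i :: L i
  · obtain ⟨l₂, l₁, hl⟩ := List.append_of_mem hj
    have hnd := hL i
    have hs := pathWeight_split w j l₁ l₂
    simp only
    rw [hl] at hnd ⊢
    have h1 : (j :: l₁).Nodup := hnd.of_append_right
    have h2 : (l₂ ++ [j]).Nodup := by
      have : List.Sublist (l₂ ++ [j]) (l₂ ++ j :: l₁) := by simp
      exact hnd.sublist this
    have h3 := hLm j l₁ h1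
    have hc : pathWeight w (l₂ ++ [j]) + w i j ≤ 0 := by
      have hhead : ∃ t, l₂ ++ [j] = i :: t := by
        cases l₂ with
        | nil => simp at hl; exact ⟨[], by simp [hl.1]⟩
        | cons a t => simp at hl; exact ⟨t ++ [j], by simp [hl.1]⟩
      obtain ⟨t, ht⟩ := hhead
      obtain ⟨σ, -, hb, hsum⟩ := exists_cycle w hw t i (ht ▸ h2)
      have hlast : σ i = j := by
        rw [hb]; simp only [← ht]; simp
      rw [hlast, ← ht] at hsum
      linarith [hσ σ]
    linarith
  · have h := hLm j (i :: L i) (List.nodup_cons.2 ⟨hj, hL i⟩)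
    simp only [pathWeight] at h
    linarith

/-- Under positive additive valuations, an allocation is
envy-freeable iff it is reassignment-stable. -/
theorem envyFreeable_iff_reassignmentStable
    {n : ℕ} {α : Type*} [Fintype α] [DecidableEq α]
    (v : Fin n → Finset α → ℝ)
    (hv0 : ∀ i, v i ∅ = 0)
    (hpos : ∀ i A, 0 ≤ v i A)
    (hadd : ∀ i, AdditiveVal (v i))
    (X : Fin n → Finset α) (hX : IsAllocation X) :
    (∃ p : Fin n → ℝ, EnvyFree v X p) ↔ ReassignmentStable v X := by
  constructor
  · rintro ⟨p, hp⟩ σ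
    have h : ∑ i, (v i (X (σ i)) - p (σ i)) ≤ ∑ i, (v i (X i) - p i) :=
      Finset.sum_le_sum fun i _ => hp i (σ i)
    rw [Finset.sum_sub_distrib, Finset.sum_sub_distrib, Equiv.sum_comp σ p] at h
    linarith
  · intro h
    obtain ⟨p, hp⟩ := exists_potential (fun i j => v i (X j) - v i (X i)) (by simp) (fun σ => by
      rw [Finset.sum_sub_distrib]
      linarith [h σ])
    refine ⟨p, fun i j => ?_⟩
    have := hp i j
    linarith
end

section
/- Under (positive) additive valuations, an allocation X is envy-freeable (there exist payments p making the outcome (X,p) envy-free) if and only if the envy-graph of X has no positive-weight cycle: for every cycle of pairwise-distinct agents i_1, i_2, ..., i_k, i_1, the sum Σ_{t=1}^{k} (v_{i_t}(X_{i_{t+1}}) - v_{i_t}(X_{i_t})) (indices mod k) is at most 0. -/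
open Finset

/-- Sum around a cycle, with the closing arc separated. -/
lemma cycle_sum_succ {n : ℕ} (w : Fin n → Fin n → ℝ) (m : ℕ) (c : ℕ → Fin n) :
    ∑ t ∈ Finset.range (m + 1), w (c t) (c ((t + 1) % (m + 1))) =
      ∑ t ∈ Finset.range m, w (c t) (c (t + 1)) + w (c m) (c 0) := by
  rw [Finset.sum_range_succ, Nat.mod_self]
  congr 1
  refine Finset.sum_congr rfl fun t ht => ?_
  rw [Nat.mod_eq_of_lt (by have := Finset.mem_range.1 ht; omega)]

/-- Weights of simple paths ending at `j`. -/
def pathWeights {n : ℕ} (w : Fin n → Fin n → ℝ) (j : Fin n) : Set ℝ :=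
  {s | ∃ (k : ℕ) (c : ℕ → Fin n), Set.InjOn c (Set.Iic k) ∧ c k = j ∧
    s = ∑ t ∈ Finset.range k, w (c t) (c (t + 1))}

lemma pathWeights_bddAbove {n : ℕ} (w : Fin n → Fin n → ℝ) (j : Fin n) :
    BddAbove (pathWeights w j) := by
  have hw : ∀ a b, w a b ≤ ∑ a, ∑ b, |w a b| := fun a b =>
    (le_abs_self _).trans <|
      (Finset.single_le_sum (f := fun b => |w a b|) (fun _ _ => abs_nonneg _)
        (Finset.mem_univ b)).trans
      (Finset.single_le_sum (f := fun a => ∑ b, |w a b|)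
        (fun _ _ => Finset.sum_nonneg fun _ _ => abs_nonneg _) (Finset.mem_univ a))
  have hM : 0 ≤ ∑ a, ∑ b, |w a b| :=
    Finset.sum_nonneg fun _ _ => Finset.sum_nonneg fun _ _ => abs_nonneg _
  refine ⟨n * ∑ a, ∑ b, |w a b|, ?_⟩
  rintro s ⟨k, c, hc, -, rfl⟩
  have hk : k ≤ n := by
    have h := Finset.card_le_card_of_injOn (s := Finset.range k)
      (t := (Finset.univ : Finset (Fin n))) c (fun _ _ => Finset.mem_coe.2 (Finset.mem_univ _))
      (hc.mono fun t ht => by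
        have := Finset.mem_range.1 (Finset.mem_coe.1 ht)
        simp only [Set.mem_Iic]; omega)
    simpa using h
  calc _ ≤ ∑ t ∈ Finset.range k, ∑ a, ∑ b, |w a b| := Finset.sum_le_sum fun _ _ => hw _ _
    _ = k * ∑ a, ∑ b, |w a b| := by simp
    _ ≤ _ := mul_le_mul_of_nonneg_right (by exact_mod_cast hk) hM

lemma exists_potential_s9 {n : ℕ} (w : Fin n → Fin n → ℝ)
    (h : ∀ (k : ℕ) (c : ℕ → Fin n), Set.InjOn c (Set.Iio k) →
      ∑ t ∈ Finset.range k, w (c t) (c ((t + 1) % k)) ≤ 0) :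
    ∃ p : Fin n → ℝ, ∀ i j, w i j ≤ p j - p i := by
  refine ⟨fun j => sSup (pathWeights w j), fun i j => ?_⟩
  suffices sSup (pathWeights w i) ≤ sSup (pathWeights w j) - w i j by linarith
  refine csSup_le ⟨0, 0, fun _ => i, ?_, rfl, by simp⟩ ?_
  · intro a ha b hb _
    simp only [Set.mem_Iic] at ha hb
    omega
  rintro s ⟨k, c, hc, hk, rfl⟩
  rw [le_sub_iff_add_le]
  by_cases hj : ∃ m ≤ k, c m = j
  · obtain ⟨m, hm, hmj⟩ := hj
    obtain ⟨d, rfl⟩ := Nat.exists_eq_add_of_le hm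
    have h1 := h (d + 1) (fun t => c (m + t)) (by
      intro a ha b hb hab
      simp only [Set.mem_Iio] at ha hb
      have := hc (x₁ := m + a) (x₂ := m + b) (by simp only [Set.mem_Iic]; omega)
        (by simp only [Set.mem_Iic]; omega) hab
      omega)
    rw [cycle_sum_succ w d (fun t => c (m + t))] at h1
    have h2 : ∑ t ∈ Finset.range m, w (c t) (c (t + 1)) ≤ sSup (pathWeights w j) :=
      le_csSup (pathWeights_bddAbove w j)
        ⟨m, c, hc.mono (Set.Iic_subset_Iic.2 hm), hmj, rfl⟩
    rw [Finset.sum_range_add]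
    simp only [add_zero, hk, hmj, ← add_assoc] at h1 ⊢
    linarith
  · push Not at hj
    refine le_csSup (pathWeights_bddAbove w j)
      ⟨k + 1, fun t => if t ≤ k then c t else j, ?_, by simp, ?_⟩
    · intro a ha b hb hab
      simp only [Set.mem_Iic] at ha hb
      dsimp only at hab
      split_ifs at hab with h1 h2 h2
      · exact hc h1 h2 hab
      · exact absurd hab (hj a h1)
      · exact absurd hab.symm (hj b h2)
      · omega
    · rw [Finset.sum_range_succ]
      congr 1
      · refine Finset.sum_congr rfl fun t ht => ?_
        have := Finset.mem_range.1 ht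
        dsimp only
        rw [if_pos (by omega), if_pos (by omega)]
      · simp [hk]

/-- Under positive additive valuations, an allocation is
envy-freeable iff its envy-graph has no positive-weight cycle. -/
theorem envyFreeable_iff_no_positive_cycle
    {n : ℕ} {α : Type*} [Fintype α] [DecidableEq α]
    (v : Fin n → Finset α → ℝ)
    (hv0 : ∀ i, v i ∅ = 0)
    (hpos : ∀ i A, 0 ≤ v i A)
    (hadd : ∀ i, AdditiveVal (v i))
    (X : Fin n → Finset α) (hX : IsAllocation X) :
    (∃ p : Fin n → ℝ, EnvyFree v X p) ↔
      ∀ (k : ℕ) (c : ℕ → Fin n), Set.InjOn c (Set.Iio k) →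
        ∑ t ∈ Finset.range k,
          (v (c t) (X (c ((t + 1) % k))) - v (c t) (X (c t))) ≤ 0 := by
  constructor
  · rintro ⟨p, hp⟩ k c -
    cases k with
    | zero => simp
    | succ m =>
      calc _ ≤ ∑ t ∈ Finset.range (m + 1), (p (c ((t + 1) % (m + 1))) - p (c t)) :=
            Finset.sum_le_sum fun t _ => by
              have := hp (c t) (c ((t + 1) % (m + 1)))
              linarith
        _ = 0 := by
            rw [cycle_sum_succ (fun a b => p b - p a) m c,
              Finset.sum_range_sub (fun t => p (c t))]
            ring
        _ ≤ 0 := le_rfl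
  · intro h
    obtain ⟨p, hp⟩ := exists_potential_s9 (fun i j => v i (X j) - v i (X i)) h
    exact ⟨p, fun i j => by have := hp i j; linarith⟩
end

section
/- Suppose n ≥ 1 agents have superadditive valuations. Then for any given allocation Y, there exist an allocation X and payments p such that: (1) the outcome (X,p) is envy-free and equitable, (2) SW(X) ≥ SW(Y), and (3) p is balanced (Σ_i p_i = 0). -/
open Finset

/-- For superadditive valuations and any allocation `Y`, there
are an allocation `X` and balanced payments `p` such that `(X, p)` is
envy-free and equitable and `SW(X) ≥ SW(Y)`. -/
theorem exists_envyFree_equitable_balanced_outcome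
    {n : ℕ} {α : Type*} [Fintype α] [DecidableEq α]
    (hn : 1 ≤ n) (v : Fin n → Finset α → ℝ)
    (hv0 : ∀ i, v i ∅ = 0)
    (hsa : ∀ i, SuperadditiveVal (v i))
    (Y : Fin n → Finset α) (hY : IsAllocation Y) :
    ∃ (X : Fin n → Finset α) (p : Fin n → ℝ),
      IsAllocation X ∧ EnvyFree v X p ∧ Equitable v X p ∧
      socialWelfare v Y ≤ socialWelfare v X ∧ ∑ i, p i = 0 := by
  classical
  obtain ⟨X, hXmem, hXmax⟩ := Finset.exists_max_image
    (Finset.univ.filter (fun X : Fin n → Finset α => IsAllocation X))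
    (fun X => socialWelfare v X) ⟨Y, by simp [hY]⟩
  have hX : IsAllocation X := by simpa using hXmem
  have hmax : ∀ Z : Fin n → Finset α, IsAllocation Z →
      socialWelfare v Z ≤ socialWelfare v X := fun Z hZ => hXmax Z (by simp [hZ])
  have key : ∀ i j : Fin n, v i (X j) ≤ v j (X j) := by
    intro i j
    by_cases hij : i = j
    · rw [hij]
    have hd := hX.1
    let Z : Fin n → Finset α :=
      fun k => if k = j then ∅ else if k = i then X i ∪ X j else X k
    have hZ : IsAllocation Z := by
      constructor
      · intro a b hab
        by_cases haj : a = j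
        · simp [Z, haj]
        by_cases hbj : b = j
        · simp [Z, hbj]
        by_cases hai : a = i
        · subst hai
          simp only [Z, haj, hbj, Ne.symm hab, if_true, if_false]
          exact Finset.disjoint_union_left.2 ⟨hd _ _ hab, hd _ _ (Ne.symm hbj)⟩
        by_cases hbi : b = i
        · subst hbi
          simp only [Z, haj, hbj, hab, if_true, if_false]
          exact Finset.disjoint_union_right.2 ⟨hd _ _ hab, hd _ _ haj⟩
        simp only [Z, haj, hbj, hai, hbi, if_false]
        exact hd _ _ hab
      · ext x
        simp only [Finset.mem_biUnion, Finset.mem_univ, true_and, iff_true]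
        have hx : x ∈ Finset.univ.biUnion X := by rw [hX.2]; simp
        simp only [Finset.mem_biUnion, Finset.mem_univ, true_and] at hx
        obtain ⟨k, hk⟩ := hx
        by_cases hkj : k = j
        · subst hkj
          exact ⟨i, by simp [Z, hij, hk]⟩
        · refine ⟨k, ?_⟩
          by_cases hki : k = i
          · subst hki
            simp [Z, hkj, hk]
          · simp [Z, hkj, hki, hk]
    have h := hmax Z hZ
    have e : ∀ f : Fin n → ℝ,
        ∑ k, f k = f i + (f j + ∑ k ∈ (Finset.univ.erase i).erase j, f k) := by
      intro f
      rw [Finset.add_sum_erase _ _ (by simp [Ne.symm hij]),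
        Finset.add_sum_erase _ _ (Finset.mem_univ i)]
    have hrest : ∑ k ∈ (Finset.univ.erase i).erase j, v k (Z k)
        = ∑ k ∈ (Finset.univ.erase i).erase j, v k (X k) := by
      refine Finset.sum_congr rfl fun k hk => ?_
      simp only [Finset.mem_erase] at hk
      simp [Z, hk.1, hk.2.1]
    have hZi : v i (Z i) = v i (X i ∪ X j) := by simp [Z, hij]
    have hZj : v j (Z j) = 0 := by simp [Z, hv0]
    unfold socialWelfare at h
    rw [e (fun k => v k (Z k)), e (fun k => v k (X k)), hrest, hZi, hZj] at h
    have := hsa i (X i) (X j) (hd i j hij)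
    linarith
  refine ⟨X, fun i => v i (X i) - socialWelfare v X / n, hX, ?_, ?_, hmax Y hY, ?_⟩
  · intro i j
    have := key i j
    linarith
  · intro i j
    ring
  · have hn0 : (n : ℝ) ≠ 0 := by
      have : n ≠ 0 := by omega
      exact_mod_cast this
    rw [Finset.sum_sub_distrib]
    simp only [Finset.sum_const, Finset.card_univ, Fintype.card_fin, nsmul_eq_mul]
    rw [mul_div_cancel₀ _ hn0]
    simp [socialWelfare]
end

section
/- Suppose n ≥ 1 agents have superadditive valuations. Then for any given allocation Y, there exist an allocation X and payments p' such that: (1) the outcome (X,p') is envy-free and equitable, (2) SW(X) ≥ SW(Y), and (3) p'_i ≤ 0 for every agent i (only subsidies are used). -/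
open Finset

/-- For superadditive valuations and any allocation `Y`, there
are an allocation `X` and nonpositive payments `p'` (subsidies only) such that
`(X, p')` is envy-free and equitable and `SW(X) ≥ SW(Y)`. -/
theorem exists_envyFree_equitable_subsidy_outcome
    {n : ℕ} {α : Type*} [Fintype α] [DecidableEq α]
    (hn : 1 ≤ n) (v : Fin n → Finset α → ℝ)
    (hv0 : ∀ i, v i ∅ = 0)
    (hsa : ∀ i, SuperadditiveVal (v i))
    (Y : Fin n → Finset α) (hY : IsAllocation Y) :
    ∃ (X : Fin n → Finset α) (p' : Fin n → ℝ),
      IsAllocation X ∧ EnvyFree v X p' ∧ Equitable v X p' ∧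
      socialWelfare v Y ≤ socialWelfare v X ∧ ∀ i, p' i ≤ 0 := by
  classical
  obtain ⟨X, hX, hmax⟩ := Set.exists_max_image {X : Fin n → Finset α | IsAllocation X}
    (socialWelfare v) (Set.toFinite _) ⟨Y, hY⟩
  have hX' : IsAllocation X := hX
  have key : ∀ i j, v i (X j) ≤ v j (X j) := by
    intro i j
    by_cases hij : i = j
    · subst hij; exact le_refl _
    let Z : Fin n → Finset α := fun k => if k = i then X i ∪ X j else if k = j then ∅ else X k
    have hZi : Z i = X i ∪ X j := by simp [Z]
    have hZj : Z j = ∅ := by simp [Z, Ne.symm hij]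
    have hZk : ∀ k, k ≠ i ∧ k ≠ j → Z k = X k := fun k hk => by simp [Z, hk.1, hk.2]
    have hZ : IsAllocation Z := by
      obtain ⟨hd, hc⟩ := hX'
      constructor
      · intro a b hab
        rw [Finset.disjoint_left]
        intro x hxa hxb
        have hd' : ∀ a b, x ∈ X a → x ∈ X b → a = b := by
          intro a b ha hb
          by_contra h
          exact Finset.disjoint_left.mp (hd a b h) ha hb
        simp only [Z] at hxa hxb
        split_ifs at hxa hxb <;> grind
      · ext x
        have hx : x ∈ Finset.univ.biUnion X := by rw [hc]; exact Finset.mem_univ x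
        simp only [Finset.mem_biUnion, Finset.mem_univ, true_and, iff_true] at hx ⊢
        obtain ⟨k, hk⟩ := hx
        by_cases h : k = i ∨ k = j
        · refine ⟨i, ?_⟩
          rw [hZi, Finset.mem_union]
          rcases h with rfl | rfl
          · exact Or.inl hk
          · exact Or.inr hk
        · push Not at h
          exact ⟨k, by rw [hZk k h]; exact hk⟩
    have h1 := hmax Z hZ
    have h2 : ∑ k, (v k (Z k) - v k (X k)) = (v i (Z i) - v i (X i)) + (v j (Z j) - v j (X j)) :=
      Fintype.sum_eq_add i j hij (fun k hk => by rw [hZk k hk, sub_self])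
    rw [Finset.sum_sub_distrib, hZi, hZj, hv0] at h2
    have h3 := hsa i (X i) (X j) (hX'.1 i j hij)
    unfold socialWelfare at h1
    linarith
  refine ⟨X, fun i => v i (X i) - ∑ k, |v k (X k)|, hX', ?_, ?_, hmax Y hY, ?_⟩
  · intro i j
    have := key i j
    dsimp only
    linarith
  · intro i j
    dsimp only
    ring
  · intro i
    have h1 := Finset.single_le_sum (f := fun k => |v k (X k)|) (fun k _ => abs_nonneg _)
      (Finset.mem_univ i)
    have h2 := le_abs_self (v i (X i))
    dsimp only at h1 ⊢
    linarith
end
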